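/- Let N ≥ 2 be an integer, g > 0, and let W₁ be the GOE resolvent built from the rescaled GOE density. Then for every z ∈ ℂ∖ℝ, −4·(g⁴/N⁴)·W₁^{(5)}(z) + 5·(z² − (4N−2)·(g/N))·(g²/N²)·W₁'''(z) − 6·(g²/N²)·z·W₁''(z) + (−z⁴ + (8N−4)·(g/N)·z² + (−16N² + 16N + 2)·(g²/N²))·W₁'(z) + z·(z² − (4N−2)·(g/N))·W₁(z) = 2N·(z² − 4g) + 10g. -/

import Mathlib

open Nat MeasureTheory

/-- The orthonormal Hermite functions' polynomial part:
`p_n(x) = He_n(x)/√(√(2π)·n!)`, orthonormal for the weight `e^{-x²/2}` on `ℝ`. -/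
noncomputable def pOrtho (n : ℕ) (x : ℝ) : ℝ :=
  Polynomial.aeval x (Polynomial.hermite n) /
    Real.sqrt (Real.sqrt (2 * Real.pi) * (n ! : ℝ))

/-- `q_n(x) = ∫_{−∞}^{x} e^{−t²/4} p_n(t) dt`. -/
noncomputable def qFun (n : ℕ) (x : ℝ) : ℝ :=
  ∫ t in Set.Iic x, Real.exp (-t ^ 2 / 4) * pOrtho n t

/-- `D_n = π^{1/4} 2^{3/4} √((n−1)!!/n!!)`. -/
noncomputable def Dconst (n : ℕ) : ℝ :=
  Real.pi ^ ((1 : ℝ) / 4) * (2 : ℝ) ^ ((3 : ℝ) / 4) *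
    Real.sqrt ((Nat.doubleFactorial (n - 1) : ℝ) / (Nat.doubleFactorial n : ℝ))

/-- `A_N = −(1/4)D_N` for even `N`, and `A_N = N^{−1/2} D_{N−1}^{−1}` for odd `N`. -/
noncomputable def Aconst (N : ℕ) : ℝ :=
  if N % 2 = 0 then -(1 / 4) * Dconst N else (Real.sqrt N)⁻¹ * (Dconst (N - 1))⁻¹

/-- The (unscaled) GOE eigenvalue density
`ρ_N(x) = √N·(e^{−x²/2}(p_N'p_{N−1} − p_N p_{N−1}') + e^{−x²/4}((1/2)q_N + A_N)p_{N−1})`. -/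
noncomputable def goeDensity (N : ℕ) (x : ℝ) : ℝ :=
  Real.sqrt N *
    (Real.exp (-x ^ 2 / 2) *
        (deriv (pOrtho N) x * pOrtho (N - 1) x - pOrtho N x * deriv (pOrtho (N - 1)) x) +
      Real.exp (-x ^ 2 / 4) * ((1 / 2) * qFun N x + Aconst N) * pOrtho (N - 1) x)

/-- The rescaled GOE density `ρ_{(1)}(x) = √(N/g)·ρ_N(√(N/g)·x)`. -/
noncomputable def goeDensityScaled (N : ℕ) (g : ℝ) (x : ℝ) : ℝ :=
  Real.sqrt ((N : ℝ) / g) * goeDensity N (Real.sqrt ((N : ℝ) / g) * x)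

/-- The GOE resolvent `W₁(z) = ∫_ℝ ρ_{(1)}(t)/(z − t) dt` for `z ∈ ℂ∖ℝ`. -/
noncomputable def goeResolvent (N : ℕ) (g : ℝ) (z : ℂ) : ℂ :=
  ∫ t : ℝ, ((goeDensityScaled N g t : ℝ) : ℂ) / (z - (t : ℂ))

open Filter Topology

section Decay

variable {𝕜 : Type*} [RCLike 𝕜]

/-- Continuous functions on `ℝ` of at most polynomial growth. -/
@[fun_prop]
def PolyGrowth (f : ℝ → 𝕜) : Prop :=
  Continuous f ∧ ∃ (k : ℕ) (C : ℝ), ∀ x, ‖f x‖ ≤ C * (1 + x ^ 2) ^ k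

/-- Continuous functions on `ℝ` decaying faster than every inverse power. -/
@[fun_prop]
def RapidDecay (f : ℝ → 𝕜) : Prop :=
  Continuous f ∧ ∀ k : ℕ, ∃ C : ℝ, ∀ x, (1 + x ^ 2) ^ k * ‖f x‖ ≤ C

namespace PolyGrowth

@[fun_prop]
theorem const (c : 𝕜) : PolyGrowth fun _ : ℝ => c :=
  ⟨continuous_const, 0, ‖c‖, fun x => by simp⟩

theorem of_bounded {f : ℝ → 𝕜} (hf : Continuous f) {C : ℝ} (h : ∀ x, ‖f x‖ ≤ C) :
    PolyGrowth f :=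
  ⟨hf, 0, C, fun x => by simpa using h x⟩

@[fun_prop]
theorem fun_id : PolyGrowth fun x : ℝ => x :=
  ⟨continuous_id, 1, 1, fun x => by
    rw [Real.norm_eq_abs, pow_one, one_mul]
    nlinarith [sq_abs x, sq_nonneg (|x| - 1)]⟩

@[fun_prop]
theorem ofReal {f : ℝ → ℝ} (hf : PolyGrowth f) : PolyGrowth fun x => (f x : ℂ) := by
  obtain ⟨hc, k, C, h⟩ := hf
  exact ⟨by fun_prop, k, C, fun x => by simpa using h x⟩

@[fun_prop]
theorem mul {f g : ℝ → 𝕜} (hf : PolyGrowth f) (hg : PolyGrowth g) :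
    PolyGrowth fun x => f x * g x := by
  obtain ⟨hfc, k, C, hf⟩ := hf
  obtain ⟨hgc, l, D, hg⟩ := hg
  refine ⟨hfc.mul hgc, k + l, C * D, fun x => ?_⟩
  calc ‖f x * g x‖ = ‖f x‖ * ‖g x‖ := norm_mul _ _
    _ ≤ (C * (1 + x ^ 2) ^ k) * (D * (1 + x ^ 2) ^ l) :=
        mul_le_mul (hf x) (hg x) (norm_nonneg _) ((norm_nonneg _).trans (hf x))
    _ = C * D * (1 + x ^ 2) ^ (k + l) := by ring

@[fun_prop]
theorem add {f g : ℝ → 𝕜} (hf : PolyGrowth f) (hg : PolyGrowth g) :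
    PolyGrowth fun x => f x + g x := by
  obtain ⟨hfc, k, C, hf⟩ := hf
  obtain ⟨hgc, l, D, hg⟩ := hg
  refine ⟨hfc.add hgc, k + l, |C| + |D|, fun x => ?_⟩
  have h1 : (1 : ℝ) ≤ 1 + x ^ 2 := by nlinarith [sq_nonneg x]
  have hk : (1 + x ^ 2) ^ k ≤ (1 + x ^ 2) ^ (k + l) := pow_le_pow_right₀ h1 (by omega)
  have hl : (1 + x ^ 2) ^ l ≤ (1 + x ^ 2) ^ (k + l) := pow_le_pow_right₀ h1 (by omega)
  calc ‖f x + g x‖ ≤ ‖f x‖ + ‖g x‖ := norm_add_le _ _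
    _ ≤ C * (1 + x ^ 2) ^ k + D * (1 + x ^ 2) ^ l := add_le_add (hf x) (hg x)
    _ ≤ |C| * (1 + x ^ 2) ^ k + |D| * (1 + x ^ 2) ^ l := by
        gcongr <;> exact le_abs_self _
    _ ≤ |C| * (1 + x ^ 2) ^ (k + l) + |D| * (1 + x ^ 2) ^ (k + l) := by gcongr
    _ = (|C| + |D|) * (1 + x ^ 2) ^ (k + l) := by ring

@[fun_prop]
theorem neg {f : ℝ → 𝕜} (hf : PolyGrowth f) : PolyGrowth fun x => -f x := by
  simpa using (const (-1 : 𝕜)).mul hf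

@[fun_prop]
theorem sub {f g : ℝ → 𝕜} (hf : PolyGrowth f) (hg : PolyGrowth g) :
    PolyGrowth fun x => f x - g x := by
  simpa only [sub_eq_add_neg] using hf.add hg.neg

@[fun_prop]
theorem pow {f : ℝ → 𝕜} (hf : PolyGrowth f) (n : ℕ) : PolyGrowth fun x => f x ^ n := by
  induction n with
  | zero => simpa using const (1 : 𝕜)
  | succ n ih => simpa only [pow_succ] using ih.mul hf

@[fun_prop]
theorem div_const {f : ℝ → 𝕜} (hf : PolyGrowth f) (c : 𝕜) : PolyGrowth fun x => f x / c := by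
  simpa only [div_eq_mul_inv] using hf.mul (const c⁻¹)

end PolyGrowth

namespace RapidDecay

theorem polyGrowth {f : ℝ → 𝕜} (hf : RapidDecay f) : PolyGrowth f := by
  obtain ⟨C, hC⟩ := hf.2 0
  exact .of_bounded hf.1 fun x => by simpa using hC x

@[fun_prop]
theorem mul_polyGrowth {f g : ℝ → 𝕜} (hf : RapidDecay f) (hg : PolyGrowth g) :
    RapidDecay fun x => f x * g x := by
  obtain ⟨hfc, hf⟩ := hf
  obtain ⟨hgc, l, D, hg⟩ := hg
  refine ⟨hfc.mul hgc, fun k => ?_⟩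
  obtain ⟨C, hC⟩ := hf (k + l)
  refine ⟨C * |D|, fun x => ?_⟩
  have hx : (0 : ℝ) < 1 + x ^ 2 := by positivity
  calc (1 + x ^ 2) ^ k * ‖f x * g x‖ = (1 + x ^ 2) ^ k * ‖f x‖ * ‖g x‖ := by
        rw [norm_mul, mul_assoc]
    _ ≤ (1 + x ^ 2) ^ k * ‖f x‖ * (|D| * (1 + x ^ 2) ^ l) := by
        gcongr
        exact (hg x).trans (by gcongr; exact le_abs_self _)
    _ = ((1 + x ^ 2) ^ (k + l) * ‖f x‖) * |D| := by ring
    _ ≤ C * |D| := by gcongr; exact hC x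

@[fun_prop]
theorem polyGrowth_mul {f g : ℝ → 𝕜} (hf : PolyGrowth f) (hg : RapidDecay g) :
    RapidDecay fun x => f x * g x := by
  simpa only [mul_comm] using hg.mul_polyGrowth hf

@[fun_prop]
theorem mul {f g : ℝ → 𝕜} (hf : RapidDecay f) (hg : RapidDecay g) :
    RapidDecay fun x => f x * g x :=
  hf.mul_polyGrowth hg.polyGrowth

@[fun_prop]
theorem add {f g : ℝ → 𝕜} (hf : RapidDecay f) (hg : RapidDecay g) :
    RapidDecay fun x => f x + g x := by
  refine ⟨hf.1.add hg.1, fun k => ?_⟩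
  obtain ⟨C, hC⟩ := hf.2 k
  obtain ⟨D, hD⟩ := hg.2 k
  refine ⟨C + D, fun x => ?_⟩
  calc (1 + x ^ 2) ^ k * ‖f x + g x‖ ≤ (1 + x ^ 2) ^ k * (‖f x‖ + ‖g x‖) := by
        gcongr; exact norm_add_le _ _
    _ ≤ C + D := by rw [mul_add]; exact add_le_add (hC x) (hD x)

@[fun_prop]
theorem neg {f : ℝ → 𝕜} (hf : RapidDecay f) : RapidDecay fun x => -f x := by
  simpa using polyGrowth_mul (.const (-1 : 𝕜)) hf

@[fun_prop]
theorem sub {f g : ℝ → 𝕜} (hf : RapidDecay f) (hg : RapidDecay g) :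
    RapidDecay fun x => f x - g x := by
  simpa only [sub_eq_add_neg] using hf.add hg.neg

@[fun_prop]
theorem div_const {f : ℝ → 𝕜} (hf : RapidDecay f) (c : 𝕜) : RapidDecay fun x => f x / c := by
  simpa only [div_eq_mul_inv] using hf.mul_polyGrowth (.const c⁻¹)

@[fun_prop]
theorem pow_two {f : ℝ → 𝕜} (hf : RapidDecay f) : RapidDecay fun x => f x ^ 2 := by
  simpa only [sq] using hf.mul hf

@[fun_prop]
theorem ofReal {f : ℝ → ℝ} (hf : RapidDecay f) : RapidDecay fun x => (f x : ℂ) := by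
  refine ⟨Complex.continuous_ofReal.comp hf.1, fun k => ?_⟩
  obtain ⟨C, hC⟩ := hf.2 k
  exact ⟨C, fun x => by simpa using hC x⟩

theorem integrable {f : ℝ → 𝕜} (hf : RapidDecay f) : Integrable f := by
  obtain ⟨C, hC⟩ := hf.2 1
  refine (integrable_inv_one_add_sq.const_mul C).mono' hf.1.aestronglyMeasurable
    (.of_forall fun x => ?_)
  rw [← div_eq_mul_inv, le_div_iff₀ (by positivity), mul_comm]
  simpa using hC x

theorem tendsto_cocompact {f : ℝ → 𝕜} (hf : RapidDecay f) : Tendsto f (cocompact ℝ) (𝓝 0) := by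
  obtain ⟨C, hC⟩ := hf.2 1
  have h : Tendsto (fun x : ℝ => C * (1 + x ^ 2)⁻¹) (cocompact ℝ) (𝓝 0) := by
    rw [← mul_zero C, cocompact_eq_atBot_atTop]
    refine Tendsto.const_mul C (Tendsto.inv_tendsto_atTop (tendsto_sup.2 ⟨?_, ?_⟩)) <;>
      refine tendsto_atTop_add_const_left _ 1 ?_
    · simpa [Function.comp_def] using
        (tendsto_pow_atTop (α := ℝ) two_ne_zero).comp tendsto_neg_atBot_atTop
    · exact tendsto_pow_atTop two_ne_zero
  refine squeeze_zero_norm (fun x => ?_) h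
  rw [← div_eq_mul_inv, le_div_iff₀ (by positivity), mul_comm]
  simpa using hC x

/-- The integral of the derivative of a rapidly decaying function vanishes. -/
theorem integral_deriv_eq_zero {f f' : ℝ → 𝕜} (hf : RapidDecay f) (hf' : RapidDecay f')
    (h : ∀ x, HasDerivAt f (f' x) x) : ∫ x, f' x = 0 :=
  integral_eq_zero_of_hasDerivAt_of_integrable h hf'.integrable hf.integrable

end RapidDecay

end Decay

/-- The Cauchy kernel is bounded on the real line. -/
theorem polyGrowth_inv_sub {w : ℂ} (hw : w.im ≠ 0) :
    PolyGrowth fun s : ℝ => (w - (s : ℂ))⁻¹ := by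
  have hne : ∀ s : ℝ, w - (s : ℂ) ≠ 0 := fun s h => hw (by simpa using congrArg Complex.im h)
  refine .of_bounded (Continuous.inv₀ (by fun_prop) hne) (C := |w.im|⁻¹) fun s => ?_
  rw [norm_inv]
  have := Complex.abs_im_le_norm (w - (s : ℂ))
  rw [Complex.sub_im, Complex.ofReal_im, sub_zero] at this
  exact inv_anti₀ (abs_pos.2 hw) this

theorem hasDerivAt_inv_sub {w : ℂ} (hw : w.im ≠ 0) (s : ℝ) :
    HasDerivAt (fun s : ℝ => (w - (s : ℂ))⁻¹) ((w - (s : ℂ))⁻¹ ^ 2) s := by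
  have hne : w - (s : ℂ) ≠ 0 := fun h => hw (by simpa using congrArg Complex.im h)
  have h1 : HasDerivAt (fun s : ℝ => w - (s : ℂ)) (-1) s :=
    (Complex.ofRealCLM.hasDerivAt (x := s)).const_sub w
  refine (h1.fun_inv hne).congr_deriv ?_
  field_simp

/-- The differential operator of the resolvent equation, applied to the Cauchy kernel and
integrated against a rapidly decaying solution `ρ₀` of the same equation on the real line, only
sees the moments of `ρ₀` of order at most two. -/
theorem integral_cauchyKernel_of_ode {ρ₀ ρ₁ ρ₂ ρ₃ ρ₄ ρ₅ : ℝ → ℂ}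
    (d₀ : RapidDecay ρ₀) (d₁ : RapidDecay ρ₁) (d₂ : RapidDecay ρ₂) (d₃ : RapidDecay ρ₃)
    (d₄ : RapidDecay ρ₄)
    (h₀ : ∀ s, HasDerivAt ρ₀ (ρ₁ s) s) (h₁ : ∀ s, HasDerivAt ρ₁ (ρ₂ s) s)
    (h₂ : ∀ s, HasDerivAt ρ₂ (ρ₃ s) s) (h₃ : ∀ s, HasDerivAt ρ₃ (ρ₄ s) s)
    (h₄ : ∀ s, HasDerivAt ρ₄ (ρ₅ s) s) (c e : ℂ)
    (ode : ∀ s : ℝ, -4 * ρ₅ s + 5 * ((s : ℂ) ^ 2 - c) * ρ₃ s - 6 * s * ρ₂ s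
      + (-(s : ℂ) ^ 4 + 2 * c * s ^ 2 + e) * ρ₁ s + s * ((s : ℂ) ^ 2 - c) * ρ₀ s = 0)
    {w : ℂ} (hw : w.im ≠ 0) :
    ∫ s : ℝ, (480 * (w - (s : ℂ))⁻¹ ^ 6 - 30 * (w ^ 2 - c) * (w - (s : ℂ))⁻¹ ^ 4
        - 12 * w * (w - (s : ℂ))⁻¹ ^ 3
        - (-w ^ 4 + 2 * c * w ^ 2 + e) * (w - (s : ℂ))⁻¹ ^ 2
        + w * (w ^ 2 - c) * (w - (s : ℂ))⁻¹) * ρ₀ s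
      = ∫ s : ℝ, (2 * w ^ 2 + 3 * w * s + 4 * (s : ℂ) ^ 2 - 3 * c) * ρ₀ s := by
  obtain ⟨K, hKw, hK, gK⟩ : ∃ K : ℝ → ℂ, (∀ s : ℝ, (w - (s : ℂ))⁻¹ = K s) ∧
      (∀ s, HasDerivAt K (K s ^ 2) s) ∧ PolyGrowth K :=
    ⟨_, fun _ => rfl, hasDerivAt_inv_sub hw, polyGrowth_inv_sub hw⟩
  have hK1 : ∀ s : ℝ, K s * (w - s) = 1 := fun s => by
    rw [← hKw]
    exact inv_mul_cancel₀ fun h => hw (by simpa using congrArg Complex.im h)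
  simp only [hKw]
  rw [← sub_eq_zero, ← integral_sub (RapidDecay.integrable (by fun_prop))
    (RapidDecay.integrable (by fun_prop))]
  have hs : ∀ s : ℝ, HasDerivAt (fun s : ℝ => (s : ℂ)) 1 s := fun s =>
    Complex.ofRealCLM.hasDerivAt (x := s)
  have hKpow : ∀ (n : ℕ) (s : ℝ), HasDerivAt (fun s => K s ^ n) (n * K s ^ (n + 1)) s := by
    intro n s
    refine ((hK s).fun_pow n).congr_deriv ?_
    cases n <;> simp; ring
  refine RapidDecay.integral_deriv_eq_zero
    (f := fun s : ℝ =>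
      (96 * K s ^ 5 - 10 * (w ^ 2 - c) * K s ^ 3 - 6 * w * K s ^ 2
          - (-w ^ 4 + 2 * c * w ^ 2 + e) * K s
          - ((w ^ 3 + w ^ 2 * s + w * (s : ℂ) ^ 2 + (s : ℂ) ^ 3) - 2 * c * (w + s))) * ρ₀ s
        + (-24 * K s ^ 4 + 5 * (w ^ 2 - c) * K s ^ 2 + 6 * w * K s - 11) * ρ₁ s
        + (8 * K s ^ 3 - 5 * (w ^ 2 - c) * K s + 5 * (w + s)) * ρ₂ s
        + (-4 * K s ^ 2) * ρ₃ s + (4 * K s) * ρ₄ s)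
    (by fun_prop) (by fun_prop) fun s => ?_
  have e₀ : HasDerivAt (fun s : ℝ => 96 * K s ^ 5 - 10 * (w ^ 2 - c) * K s ^ 3
      - 6 * w * K s ^ 2 - (-w ^ 4 + 2 * c * w ^ 2 + e) * K s
      - ((w ^ 3 + w ^ 2 * s + w * (s : ℂ) ^ 2 + (s : ℂ) ^ 3) - 2 * c * (w + s))) _ s :=
    ((((hKpow 5 s).const_mul 96).sub ((hKpow 3 s).const_mul _)).sub
      ((hKpow 2 s).const_mul _)).sub ((hK s).const_mul _) |>.sub
      (((((hs s).const_mul _).const_add _).add (((hs s).fun_pow 2).const_mul w)).add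
        ((hs s).fun_pow 3) |>.sub (((hs s).const_add w).const_mul _))
  have e₁ : HasDerivAt (fun s : ℝ => -24 * K s ^ 4 + 5 * (w ^ 2 - c) * K s ^ 2
      + 6 * w * K s - 11) _ s :=
    (((hKpow 4 s).const_mul (-24)).add ((hKpow 2 s).const_mul _)).add
      ((hK s).const_mul _) |>.sub_const 11
  have e₂ : HasDerivAt (fun s : ℝ => 8 * K s ^ 3 - 5 * (w ^ 2 - c) * K s + 5 * (w + s)) _ s :=
    (((hKpow 3 s).const_mul 8).sub ((hK s).const_mul _)).add (((hs s).const_add w).const_mul 5)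
  refine ((((e₀.mul (h₀ s)).add (e₁.mul (h₁ s))).add (e₂.mul (h₂ s))).add
    (((hKpow 2 s).const_mul (-4)).mul (h₃ s)) |>.add
    (((hK s).const_mul 4).mul (h₄ s))).congr_deriv ?_
  push_cast
  linear_combination (-K s) * ode s - (5 * (w + s) * ρ₃ s - 6 * ρ₂ s
    + (-(w ^ 3 + w ^ 2 * s + w * (s : ℂ) ^ 2 + (s : ℂ) ^ 3) + 2 * c * (w + s)) * ρ₁ s
    + (w ^ 2 + w * s + (s : ℂ) ^ 2 - c) * ρ₀ s) * hK1 s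

section Ladder

variable {F H G : ℝ → ℝ} {n : ℝ}

/-- The GOE density, up to normalization, in terms of two consecutive Hermite functions `F`, `H`
and a primitive `G` of `H / 2`. -/
def ladderDensity (F H G : ℝ → ℝ) (n s : ℝ) : ℝ :=
  n * F s ^ 2 - s * (F s * H s) + H s ^ 2 + F s * G s

theorem integral_ladderDensity (dF : RapidDecay F) (dH : RapidDecay H) (gG : PolyGrowth G)
    (hF : ∀ s, HasDerivAt F (s / 2 * F s - H s) s)
    (hH : ∀ s, HasDerivAt H (n * F s - s / 2 * H s) s) {h : ℝ}
    (iF : ∫ s, F s ^ 2 = h) (iFG : ∫ s, F s * G s = 0) :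
    ∫ s, ladderDensity F H G n s = n * h := by
  have key : ∫ s, (ladderDensity F H G n s - (n * F s ^ 2 + F s * G s)) = 0 := by
    unfold ladderDensity
    refine RapidDecay.integral_deriv_eq_zero
      (f := fun s => -(1 / 2) * (s ^ 2 * (F s * H s) - s * H s ^ 2 - n * s * F s ^ 2 + F s * H s))
      (by fun_prop) (by fun_prop) fun s => ?_
    refine (((((((hasDerivAt_id s).fun_pow 2).mul ((hF s).mul (hH s))).sub
      ((hasDerivAt_id s).mul ((hH s).fun_pow 2))).sub
      (((hasDerivAt_id s).const_mul n).mul ((hF s).fun_pow 2))).add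
      ((hF s).mul (hH s))).const_mul _).congr_deriv ?_
    simp only [id, Pi.mul_apply]
    push_cast
    ring
  rw [integral_sub (RapidDecay.integrable (by unfold ladderDensity; fun_prop))
      (RapidDecay.integrable (by fun_prop)), sub_eq_zero] at key
  rw [key, integral_add (RapidDecay.integrable (by fun_prop))
    (RapidDecay.integrable (by fun_prop)), integral_const_mul, iF, iFG, add_zero]

theorem integral_mul_ladderDensity (dF : RapidDecay F) (dH : RapidDecay H) (gG : PolyGrowth G)
    (hF : ∀ s, HasDerivAt F (s / 2 * F s - H s) s)
    (hH : ∀ s, HasDerivAt H (n * F s - s / 2 * H s) s)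
    (hG : ∀ s, HasDerivAt G (H s / 2) s) (iHG : ∫ s, H s * G s = 0) :
    ∫ s, s * ladderDensity F H G n s = 0 := by
  have key : ∫ s, (s * ladderDensity F H G n s - 2 * (H s * G s)) = 0 := by
    unfold ladderDensity
    refine RapidDecay.integral_deriv_eq_zero
      (f := fun s => (1 / 2 * s ^ 2 - 4 / 3 * n + 1) * (n * F s ^ 2 - s * (F s * H s) + H s ^ 2)
        + 1 / 6 * (s ^ 3 * (F s * H s) - s ^ 2 * H s ^ 2 - n * s ^ 2 * F s ^ 2
          + 2 * n * F s ^ 2 - 2 * H s ^ 2) + 2 * (F s * G s))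
      (by fun_prop) (by fun_prop) fun s => ?_
    have i := hasDerivAt_id s
    have fh := (hF s).mul (hH s)
    have f2 := (hF s).fun_pow 2
    have h2 := (hH s).fun_pow 2
    refine (((((((i.fun_pow 2).const_mul (1 / 2)).sub_const _).add_const 1).mul
      (((f2.const_mul n).sub (i.mul fh)).add h2)).add
      ((((((i.fun_pow 3).mul fh).sub ((i.fun_pow 2).mul h2)).sub
        (((i.fun_pow 2).const_mul n).mul f2)).add (f2.const_mul (2 * n))).sub
          (h2.const_mul 2) |>.const_mul (1 / 6))).add
      (((hF s).mul (hG s)).const_mul 2)).congr_deriv ?_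
    simp only [id, Pi.mul_apply, Pi.add_apply, Pi.sub_apply]
    push_cast
    ring
  rw [integral_sub (RapidDecay.integrable (by unfold ladderDensity; fun_prop))
      (RapidDecay.integrable (by fun_prop)), sub_eq_zero] at key
  rw [key, integral_const_mul, iHG, mul_zero]

theorem integral_sq_mul_ladderDensity (dF : RapidDecay F) (dH : RapidDecay H)
    (gG : PolyGrowth G)
    (hF : ∀ s, HasDerivAt F (s / 2 * F s - H s) s)
    (hH : ∀ s, HasDerivAt H (n * F s - s / 2 * H s) s)
    (hG : ∀ s, HasDerivAt G (H s / 2) s) {h : ℝ}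
    (iF : ∫ s, F s ^ 2 = h) (iFG : ∫ s, F s * G s = 0) :
    ∫ s, s ^ 2 * ladderDensity F H G n s = (n ^ 2 + n) * h := by
  have key : ∫ s, (s ^ 2 * ladderDensity F H G n s
      - ((n ^ 2 + n) * F s ^ 2 + (4 * n - 2) * (F s * G s))) = 0 := by
    unfold ladderDensity
    refine RapidDecay.integral_deriv_eq_zero
      (f := fun s => 1 / 3 * s ^ 3 * (n * F s ^ 2 - s * (F s * H s) + H s ^ 2)
        + 1 / 12 * (s ^ 4 * (F s * H s) - s ^ 3 * H s ^ 2 - n * s ^ 3 * F s ^ 2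
          - 3 * s * H s ^ 2 + 3 * n * s * F s ^ 2 - 3 * (F s * H s))
        + (n - 1) / 2 * (s ^ 2 * (F s * H s) - s * H s ^ 2 - n * s * F s ^ 2 - F s * H s)
        + 4 * ((s / 2 * F s - H s) * G s) - 2 * (F s * H s))
      (by fun_prop) (by fun_prop) fun s => ?_
    have i := hasDerivAt_id s
    have fh := (hF s).mul (hH s)
    have f2 := (hF s).fun_pow 2
    have h2 := (hH s).fun_pow 2
    refine (((((((i.fun_pow 3).const_mul (1 / 3)).mul
      (((f2.const_mul n).sub (i.mul fh)).add h2)).add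
      (((((((i.fun_pow 4).mul fh).sub ((i.fun_pow 3).mul h2)).sub
        (((i.fun_pow 3).const_mul n).mul f2)).sub ((i.const_mul 3).mul h2)).add
        ((i.const_mul (3 * n)).mul f2)).sub (fh.const_mul 3) |>.const_mul (1 / 12))).add
      (((((i.fun_pow 2).mul fh).sub (i.mul h2)).sub ((i.const_mul n).mul f2)).sub fh
        |>.const_mul ((n - 1) / 2))).add
      (((((i.div_const 2).mul (hF s)).sub (hH s)).mul (hG s)).const_mul 4)).sub
      (fh.const_mul 2)).congr_deriv ?_
    simp only [id, Pi.mul_apply, Pi.add_apply, Pi.sub_apply]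
    push_cast
    ring
  rw [integral_sub (RapidDecay.integrable (by unfold ladderDensity; fun_prop))
      (RapidDecay.integrable (by fun_prop)), sub_eq_zero] at key
  rw [key, integral_add (RapidDecay.integrable (by fun_prop))
    (RapidDecay.integrable (by fun_prop)), integral_const_mul, integral_const_mul, iF, iFG,
    mul_zero, add_zero]

/-- The first five derivatives of `ladderDensity` are again combinations of products of `F`, `H`
and `G`, and they satisfy a homogeneous linear equation of order five. -/
theorem exists_derivs_ladderDensity (dF : RapidDecay F) (dH : RapidDecay H) (gG : PolyGrowth G)
    (hF : ∀ s, HasDerivAt F (s / 2 * F s - H s) s)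
    (hH : ∀ s, HasDerivAt H (n * F s - s / 2 * H s) s)
    (hG : ∀ s, HasDerivAt G (H s / 2) s) :
    ∃ ρ₁ ρ₂ ρ₃ ρ₄ ρ₅ : ℝ → ℝ, RapidDecay ρ₁ ∧ RapidDecay ρ₂ ∧ RapidDecay ρ₃ ∧ RapidDecay ρ₄ ∧
      (∀ s, HasDerivAt (ladderDensity F H G n) (ρ₁ s) s) ∧ (∀ s, HasDerivAt ρ₁ (ρ₂ s) s) ∧
      (∀ s, HasDerivAt ρ₂ (ρ₃ s) s) ∧ (∀ s, HasDerivAt ρ₃ (ρ₄ s) s) ∧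
      (∀ s, HasDerivAt ρ₄ (ρ₅ s) s) ∧
      ∀ s, -4 * ρ₅ s + 5 * (s ^ 2 - (4 * n - 2)) * ρ₃ s - 6 * s * ρ₂ s
        + (-s ^ 4 + 2 * (4 * n - 2) * s ^ 2 + (-16 * n ^ 2 + 16 * n + 2)) * ρ₁ s
        + s * (s ^ 2 - (4 * n - 2)) * ladderDensity F H G n s = 0 := by
  have i := fun s : ℝ => hasDerivAt_id' s
  have i2 := fun s => (i s).fun_pow 2
  have i3 := fun s => (i s).fun_pow 3
  have i4 := fun s => (i s).fun_pow 4
  have f2 := fun s => (hF s).fun_pow 2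
  have h2 := fun s => (hH s).fun_pow 2
  have fh := fun s => (hF s).fun_mul (hH s)
  have fg := fun s => (hF s).fun_mul (hG s)
  have hg := fun s => (hH s).fun_mul (hG s)
  have e₀ : ∀ s, HasDerivAt (ladderDensity F H G n)
      (-1 / 2 * (F s * H s) + s / 2 * (F s * G s) - H s * G s) s := by
    intro s
    refine (((((f2 s).const_mul n).sub ((i s).mul (fh s))).add (h2 s)).add (fg s)).congr_deriv ?_
    push_cast
    ring
  have e₁ : ∀ s, HasDerivAt
      (fun s => -1 / 2 * (F s * H s) + s / 2 * (F s * G s) - H s * G s)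
      (-n / 2 * F s ^ 2 + s / 4 * (F s * H s) + (1 / 2 - n + s ^ 2 / 4) * (F s * G s)) s := by
    intro s
    refine ((((fh s).const_mul _).add (((i s).div_const 2).mul (fg s))).sub (hg s)).congr_deriv ?_
    ring
  have e₂ : ∀ s, HasDerivAt
      (fun s => -n / 2 * F s ^ 2 + s / 4 * (F s * H s) + (1 / 2 - n + s ^ 2 / 4) * (F s * G s))
      (-n / 4 * s * F s ^ 2 + (1 / 2 + n / 2 + s ^ 2 / 8) * (F s * H s) - s / 4 * H s ^ 2
        + ((3 / 4 - n / 2) * s + s ^ 3 / 8) * (F s * G s)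
        - (1 / 2 - n + s ^ 2 / 4) * (H s * G s)) s := by
    intro s
    refine ((((f2 s).const_mul _).add (((i s).div_const 4).mul (fh s))).add
      ((((i2 s).div_const 4).const_add _).mul (fg s))).congr_deriv ?_
    push_cast
    ring
  have e₃ : ∀ s, HasDerivAt
      (fun s => -n / 4 * s * F s ^ 2 + (1 / 2 + n / 2 + s ^ 2 / 8) * (F s * H s)
        - s / 4 * H s ^ 2 + ((3 / 4 - n / 2) * s + s ^ 3 / 8) * (F s * G s)
        - (1 / 2 - n + s ^ 2 / 4) * (H s * G s))
      ((n / 4 + n ^ 2 / 2 - n / 8 * s ^ 2) * F s ^ 2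
        + ((5 / 8 - n / 4) * s + s ^ 3 / 16) * (F s * H s) - H s ^ 2
        + (3 / 4 - n + n ^ 2 + (3 / 4 - n / 2) * s ^ 2 + s ^ 4 / 16) * (F s * G s)
        - s * (H s * G s)) s := by
    intro s
    refine ((((((i s).const_mul _).mul (f2 s)).add ((((i2 s).div_const 8).const_add _).mul
      (fh s))).sub (((i s).div_const 4).mul (h2 s))).add
      ((((i s).const_mul _).add ((i3 s).div_const 8)).mul (fg s))).sub
      ((((i2 s).div_const 4).const_add _).mul (hg s)) |>.congr_deriv ?_
    simp only [Pi.add_apply]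
    push_cast
    ring
  have e₄ : ∀ s, HasDerivAt
      (fun s => (n / 4 + n ^ 2 / 2 - n / 8 * s ^ 2) * F s ^ 2
        + ((5 / 8 - n / 4) * s + s ^ 3 / 16) * (F s * H s) - H s ^ 2
        + (3 / 4 - n + n ^ 2 + (3 / 4 - n / 2) * s ^ 2 + s ^ 4 / 16) * (F s * G s)
        - s * (H s * G s))
      (((5 / 8 * n + n ^ 2 / 4) * s - n / 16 * s ^ 3) * F s ^ 2
        + (1 - 13 / 4 * n - n ^ 2 / 2 + 9 / 16 * s ^ 2 + s ^ 4 / 32) * (F s * H s)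
        + ((n / 4 - 1 / 8) * s - s ^ 3 / 16) * H s ^ 2
        + ((15 / 8 - 5 / 2 * n + n ^ 2 / 2) * s + (5 / 8 - n / 4) * s ^ 3 + s ^ 5 / 32)
          * (F s * G s)
        + (-7 / 4 + n - n ^ 2 + (n / 2 - 1 / 4) * s ^ 2 - s ^ 4 / 16) * (H s * G s)) s := by
    intro s
    refine ((((((i2 s).const_mul _).const_sub _).mul (f2 s)).add
      ((((i s).const_mul _).add ((i3 s).div_const 16)).mul (fh s))).sub (h2 s)).add
      (((((i2 s).const_mul _).const_add _).add ((i4 s).div_const 16)).mul (fg s)) |>.sub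
      ((i s).mul (hg s)) |>.congr_deriv ?_
    simp only [Pi.add_apply]
    push_cast
    ring
  refine ⟨_, _, _, _, _, ?_, ?_, ?_, ?_, e₀, e₁, e₂, e₃, e₄, fun s => ?_⟩
  iterate 4 fun_prop
  unfold ladderDensity
  ring

/-- The resolvent equation for `ladderDensity`, in integrated form. -/
theorem integral_cauchyKernel_ladderDensity (dF : RapidDecay F) (dH : RapidDecay H)
    (gG : PolyGrowth G)
    (hF : ∀ s, HasDerivAt F (s / 2 * F s - H s) s)
    (hH : ∀ s, HasDerivAt H (n * F s - s / 2 * H s) s)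
    (hG : ∀ s, HasDerivAt G (H s / 2) s) {h : ℝ}
    (iF : ∫ s, F s ^ 2 = h) (iFG : ∫ s, F s * G s = 0) (iHG : ∫ s, H s * G s = 0)
    {w : ℂ} (hw : w.im ≠ 0) :
    ∫ s : ℝ, (480 * (w - (s : ℂ))⁻¹ ^ 6 - 30 * (w ^ 2 - (4 * n - 2)) * (w - (s : ℂ))⁻¹ ^ 4
        - 12 * w * (w - (s : ℂ))⁻¹ ^ 3
        - (-w ^ 4 + 2 * (4 * n - 2) * w ^ 2 + (-16 * n ^ 2 + 16 * n + 2)) * (w - (s : ℂ))⁻¹ ^ 2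
        + w * (w ^ 2 - (4 * n - 2)) * (w - (s : ℂ))⁻¹) * (ladderDensity F H G n s : ℂ)
      = (2 * n * w ^ 2 - 8 * n ^ 2 + 10 * n) * h := by
  obtain ⟨ρ₁, ρ₂, ρ₃, ρ₄, ρ₅, d₁, d₂, d₃, d₄, e₀, e₁, e₂, e₃, e₄, ode⟩ :=
    exists_derivs_ladderDensity dF dH gG hF hH hG
  have d₀ : RapidDecay (ladderDensity F H G n) := by unfold ladderDensity; fun_prop
  rw [integral_cauchyKernel_of_ode d₀.ofReal d₁.ofReal d₂.ofReal d₃.ofReal d₄.ofReal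
    (fun s => (e₀ s).ofReal_comp) (fun s => (e₁ s).ofReal_comp) (fun s => (e₂ s).ofReal_comp)
    (fun s => (e₃ s).ofReal_comp) (fun s => (e₄ s).ofReal_comp) _ _
    (fun s => by exact_mod_cast congrArg Complex.ofReal (ode s)) hw]
  have m₀ := congrArg Complex.ofReal (integral_ladderDensity dF dH gG hF hH iF iFG)
  have m₁ := congrArg Complex.ofReal (integral_mul_ladderDensity dF dH gG hF hH hG iHG)
  have m₂ := congrArg Complex.ofReal (integral_sq_mul_ladderDensity dF dH gG hF hH hG iF iFG)
  rw [← integral_complex_ofReal] at m₀ m₁ m₂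
  push_cast at m₀ m₁ m₂
  have split : ∀ s : ℝ, (2 * w ^ 2 + 3 * w * s + 4 * (s : ℂ) ^ 2 - 3 * (4 * n - 2))
      * (ladderDensity F H G n s : ℂ)
      = (2 * w ^ 2 - 3 * (4 * n - 2)) * ladderDensity F H G n s
        + 3 * w * (s * ladderDensity F H G n s)
        + 4 * ((s : ℂ) ^ 2 * ladderDensity F H G n s) := fun s => by ring
  simp_rw [split]
  rw [integral_add (RapidDecay.integrable (by fun_prop)) (RapidDecay.integrable (by fun_prop)),
    integral_add (RapidDecay.integrable (by fun_prop)) (RapidDecay.integrable (by fun_prop)),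
    integral_const_mul, integral_const_mul, integral_const_mul, m₀, m₁, m₂]
  ring

end Ladder

/-- Powers of the Cauchy kernel may be differentiated under the integral sign. -/
theorem hasDerivAt_integral_mul_inv_sub_pow {f : ℝ → ℂ} (hf : Integrable f) (m : ℕ) {w : ℂ}
    (hw : w.im ≠ 0) :
    HasDerivAt (fun z : ℂ => ∫ t : ℝ, f t * (z - (t : ℂ))⁻¹ ^ (m + 1))
      (-(m + 1) * ∫ t : ℝ, f t * (w - (t : ℂ))⁻¹ ^ (m + 2)) w := by
  set δ := |w.im| / 2 with hδ
  have hδ0 : 0 < δ := by have := abs_pos.2 hw; positivity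
  have him : ∀ z ∈ Metric.ball w δ, δ ≤ |z.im| := by
    intro z hz
    have h1 : |(z - w).im| < δ := (Complex.abs_im_le_norm _).trans_lt
      (by simpa [dist_eq_norm] using hz)
    have h2 := abs_sub_abs_le_abs_sub w.im z.im
    rw [Complex.sub_im, abs_sub_comm] at h1
    linarith
  have hne : ∀ z ∈ Metric.ball w δ, ∀ t : ℝ, z - (t : ℂ) ≠ 0 := by
    intro z hz t h
    have h1 : z.im = 0 := by simpa using congrArg Complex.im h
    have h2 := him z hz
    rw [h1, abs_zero] at h2
    linarith
  have hbound : ∀ z ∈ Metric.ball w δ, ∀ t : ℝ, ‖(z - (t : ℂ))⁻¹‖ ≤ δ⁻¹ := by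
    intro z hz t
    rw [norm_inv]
    refine inv_anti₀ hδ0 ((him z hz).trans ?_)
    simpa using Complex.abs_im_le_norm (z - (t : ℂ))
  have hcont : ∀ z ∈ Metric.ball w δ, ∀ k : ℕ, Continuous fun t : ℝ => (z - (t : ℂ))⁻¹ ^ k :=
    fun z hz k => (Continuous.inv₀ (by fun_prop) (hne z hz)).pow k
  have hint : ∀ z ∈ Metric.ball w δ, ∀ k : ℕ,
      Integrable fun t : ℝ => f t * (z - (t : ℂ))⁻¹ ^ k := fun z hz k =>
    hf.mul_bdd (c := δ⁻¹ ^ k) (hcont z hz k).aestronglyMeasurable (.of_forall fun t => by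
      rw [norm_pow]
      exact pow_le_pow_left₀ (norm_nonneg _) (hbound z hz t) k)
  have hw' : w ∈ Metric.ball w δ := Metric.mem_ball_self hδ0
  rw [← integral_const_mul]
  refine (hasDerivAt_integral_of_dominated_loc_of_deriv_le (Metric.ball_mem_nhds w hδ0)
    (F := fun z t => f t * (z - (t : ℂ))⁻¹ ^ (m + 1))
    (F' := fun z t => -(m + 1) * (f t * (z - (t : ℂ))⁻¹ ^ (m + 2)))
    (bound := fun t => (m + 1) * (‖f t‖ * δ⁻¹ ^ (m + 2)))
    ?_ (hint w hw' _) ((hint w hw' _).const_mul _).aestronglyMeasurable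
    (.of_forall fun t z hz => ?_) ((hf.norm.mul_const _).const_mul _)
    (.of_forall fun t z hz => ?_)).2
  · filter_upwards [Metric.ball_mem_nhds w hδ0] with z hz
    exact (hint z hz _).aestronglyMeasurable
  · rw [norm_mul, norm_mul, norm_pow, norm_neg]
    have : ‖(m + 1 : ℂ)‖ = m + 1 := by exact_mod_cast Complex.norm_natCast (m + 1)
    rw [this]
    gcongr
    exact hbound z hz t
  · have h1 : HasDerivAt (fun z : ℂ => (z - (t : ℂ))⁻¹) (-(z - (t : ℂ))⁻¹ ^ 2) z := by
      refine (((hasDerivAt_id z).sub_const (t : ℂ)).fun_inv (hne z hz t)).congr_deriv ?_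
      simp [neg_div]
    refine ((h1.fun_pow (m + 1)).const_mul (f t)).congr_deriv ?_
    push_cast
    ring

theorem iteratedDeriv_integral_inv_sub {f : ℝ → ℂ} (hf : Integrable f) (k : ℕ) {w : ℂ}
    (hw : w.im ≠ 0) :
    iteratedDeriv k (fun z : ℂ => ∫ t : ℝ, f t * (z - (t : ℂ))⁻¹) w
      = (-1) ^ k * k ! * ∫ t : ℝ, f t * (w - (t : ℂ))⁻¹ ^ (k + 1) := by
  induction k generalizing w with
  | zero => simp
  | succ k ih =>
    have hev : iteratedDeriv k (fun z : ℂ => ∫ t : ℝ, f t * (z - (t : ℂ))⁻¹) =ᶠ[𝓝 w]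
        fun z => (-1) ^ k * k ! * ∫ t : ℝ, f t * (z - (t : ℂ))⁻¹ ^ (k + 1) := by
      filter_upwards [(isOpen_ne.preimage Complex.continuous_im).mem_nhds hw] with z hz
      exact ih hz
    rw [iteratedDeriv_succ, hev.deriv_eq,
      ((hasDerivAt_integral_mul_inv_sub_pow hf k hw).const_mul _).deriv, Nat.factorial_succ]
    push_cast
    ring

section HermiteFunctions

open Polynomial in
theorem derivative_hermite_succ (n : ℕ) :
    derivative (hermite (n + 1)) = (n + 1 : ℤ[X]) * hermite n := by
  induction n with
  | zero => simp
  | succ n ih =>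
    rw [hermite_succ, derivative_sub, derivative_mul, derivative_X, ih, derivative_mul]
    have : derivative (n + 1 : ℤ[X]) = 0 := by simp
    rw [this, hermite_succ n]
    push_cast
    ring

/-- The function `He_n(x) e^{-x²/4}`. -/
noncomputable def hermiteFun (n : ℕ) (x : ℝ) : ℝ :=
  Polynomial.aeval x (Polynomial.hermite n) * Real.exp (-x ^ 2 / 4)

theorem hasDerivAt_aeval_hermite (n : ℕ) (x : ℝ) :
    HasDerivAt (fun x : ℝ => Polynomial.aeval x (Polynomial.hermite n))
      (x * Polynomial.aeval x (Polynomial.hermite n)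
        - Polynomial.aeval x (Polynomial.hermite (n + 1))) x := by
  refine ((Polynomial.hermite n).hasDerivAt_aeval x).congr_deriv ?_
  rw [Polynomial.hermite_succ]
  simp

theorem hasDerivAt_exp_neg_sq_div_four (x : ℝ) :
    HasDerivAt (fun x : ℝ => Real.exp (-x ^ 2 / 4)) (-(x / 2) * Real.exp (-x ^ 2 / 4)) x := by
  refine ((((hasDerivAt_id' x).fun_pow 2).fun_neg.div_const 4).exp).congr_deriv ?_
  push_cast
  ring

theorem hasDerivAt_hermiteFun (n : ℕ) (x : ℝ) :
    HasDerivAt (hermiteFun n) (x / 2 * hermiteFun n x - hermiteFun (n + 1) x) x := by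
  refine ((hasDerivAt_aeval_hermite n x).mul (hasDerivAt_exp_neg_sq_div_four x)).congr_deriv ?_
  unfold hermiteFun
  ring

/-- The three-term recurrence of the Hermite functions. -/
theorem hermiteFun_add_two (n : ℕ) (x : ℝ) :
    hermiteFun (n + 2) x = x * hermiteFun (n + 1) x - (n + 1) * hermiteFun n x := by
  unfold hermiteFun
  rw [Polynomial.hermite_succ (n + 1), derivative_hermite_succ]
  simp
  ring

theorem hasDerivAt_hermiteFun_succ (n : ℕ) (x : ℝ) :
    HasDerivAt (hermiteFun (n + 1))
      ((n + 1) * hermiteFun n x - x / 2 * hermiteFun (n + 1) x) x := by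
  refine (hasDerivAt_hermiteFun (n + 1) x).congr_deriv ?_
  rw [hermiteFun_add_two]
  ring

theorem rapidDecay_exp_neg_sq_div_four : RapidDecay fun x : ℝ => Real.exp (-x ^ 2 / 4) := by
  refine ⟨by fun_prop, fun k => ⟨4 ^ k * k ! * Real.exp (1 / 4), fun x => ?_⟩⟩
  have h := Real.pow_div_factorial_le_exp ((1 + x ^ 2) / 4) (by positivity) k
  rw [div_le_iff₀ (by positivity), div_pow, div_le_iff₀ (by positivity)] at h
  have e : Real.exp ((1 + x ^ 2) / 4) * Real.exp (-x ^ 2 / 4) = Real.exp (1 / 4) := by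
    rw [← Real.exp_add]
    congr 1
    ring
  rw [Real.norm_of_nonneg (Real.exp_pos _).le, ← e]
  calc (1 + x ^ 2) ^ k * Real.exp (-x ^ 2 / 4)
      ≤ (Real.exp ((1 + x ^ 2) / 4) * k ! * 4 ^ k) * Real.exp (-x ^ 2 / 4) := by gcongr
    _ = _ := by ring

theorem hermiteFun_zero (x : ℝ) : hermiteFun 0 x = Real.exp (-x ^ 2 / 4) := by
  simp [hermiteFun]

theorem hermiteFun_one (x : ℝ) : hermiteFun 1 x = x * hermiteFun 0 x := by
  simp [hermiteFun]

@[fun_prop]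
theorem rapidDecay_hermiteFun (n : ℕ) : RapidDecay (hermiteFun n) := by
  induction n using Nat.twoStepInduction with
  | zero => exact funext hermiteFun_zero ▸ rapidDecay_exp_neg_sq_div_four
  | one =>
    have : hermiteFun 1 = fun x => x * Real.exp (-x ^ 2 / 4) :=
      funext fun x => by rw [hermiteFun_one, hermiteFun_zero]
    exact this ▸ RapidDecay.polyGrowth_mul .fun_id rapidDecay_exp_neg_sq_div_four
  | more n h0 h1 =>
    have : hermiteFun (n + 2) = fun x => x * hermiteFun (n + 1) x - (n + 1) * hermiteFun n x :=
      funext (hermiteFun_add_two n)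
    rw [this]
    fun_prop

theorem integral_hermiteFun_sq (n : ℕ) :
    ∫ x, hermiteFun n x ^ 2 = √(2 * Real.pi) * n ! := by
  induction n with
  | zero =>
    have h : ∀ x : ℝ, hermiteFun 0 x ^ 2 = Real.exp (-(1 / 2) * x ^ 2) := fun x => by
      rw [hermiteFun_zero, ← Real.exp_nat_mul]
      congr 1
      push_cast
      ring
    simp_rw [h]
    rw [integral_gaussian, Nat.factorial_zero, Nat.cast_one, mul_one]
    congr 1
    ring
  | succ n ih =>
    have key : ∫ x, ((n + 1) * hermiteFun n x ^ 2 - hermiteFun (n + 1) x ^ 2) = 0 := by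
      refine RapidDecay.integral_deriv_eq_zero
        (f := fun x => hermiteFun n x * hermiteFun (n + 1) x) (by fun_prop) (by fun_prop)
        fun x => ?_
      refine ((hasDerivAt_hermiteFun n x).mul (hasDerivAt_hermiteFun_succ n x)).congr_deriv ?_
      ring
    rw [integral_sub (RapidDecay.integrable (by fun_prop)) (RapidDecay.integrable (by fun_prop)),
      integral_const_mul, ih, sub_eq_zero] at key
    rw [← key, Nat.factorial_succ]
    push_cast
    ring

/-- Passing from index `n` to `n + 2` changes `n + 1` times a Hermite function by a derivative. -/
theorem hasDerivAt_neg_two_mul_hermiteFun (n : ℕ) (x : ℝ) :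
    HasDerivAt (fun x => -2 * hermiteFun (n + 1) x)
      (hermiteFun (n + 2) x - (n + 1) * hermiteFun n x) x := by
  refine ((hasDerivAt_hermiteFun_succ n x).const_mul (-2)).congr_deriv ?_
  rw [hermiteFun_add_two]
  ring

theorem integral_hermiteFun_zero : ∫ x, hermiteFun 0 x = 2 * √Real.pi := by
  have h : ∀ x : ℝ, hermiteFun 0 x = Real.exp (-(1 / 4) * x ^ 2) := fun x => by
    rw [hermiteFun_zero]
    congr 1
    ring
  simp_rw [h]
  rw [integral_gaussian, show Real.pi / (1 / 4) = 2 ^ 2 * Real.pi by ring,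
    Real.sqrt_mul (by positivity), Real.sqrt_sq (by norm_num)]

theorem hasDerivAt_neg_two_mul_hermiteFun_zero (x : ℝ) :
    HasDerivAt (fun x => -2 * hermiteFun 0 x) (hermiteFun 1 x) x := by
  refine ((hasDerivAt_hermiteFun 0 x).const_mul (-2)).congr_deriv ?_
  rw [zero_add, hermiteFun_one]
  ring

theorem integral_hermiteFun_one : ∫ x, hermiteFun 1 x = 0 :=
  RapidDecay.integral_deriv_eq_zero (f := fun x => -2 * hermiteFun 0 x) (by fun_prop)
    (by fun_prop) hasDerivAt_neg_two_mul_hermiteFun_zero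

theorem integral_hermiteFun_add_two (n : ℕ) :
    ∫ x, hermiteFun (n + 2) x = (n + 1) * ∫ x, hermiteFun n x := by
  have key := RapidDecay.integral_deriv_eq_zero (f := fun x => -2 * hermiteFun (n + 1) x)
    (by fun_prop) (by fun_prop) (hasDerivAt_neg_two_mul_hermiteFun n)
  rwa [integral_sub (RapidDecay.integrable (by fun_prop)) (RapidDecay.integrable (by fun_prop)),
    integral_const_mul, sub_eq_zero] at key

theorem tendsto_hermiteFun_atBot (n : ℕ) : Tendsto (hermiteFun n) atBot (𝓝 0) :=
  (rapidDecay_hermiteFun n).tendsto_cocompact.mono_left atBot_le_cocompact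

theorem setIntegral_Iic_hermiteFun_one (x : ℝ) :
    ∫ t in Set.Iic x, hermiteFun 1 t = -2 * hermiteFun 0 x := by
  have h := integral_Iic_of_hasDerivAt_of_tendsto'
    (fun t (_ : t ∈ Set.Iic x) => hasDerivAt_neg_two_mul_hermiteFun_zero t)
    (rapidDecay_hermiteFun 1).integrable.integrableOn
    ((tendsto_hermiteFun_atBot 0).const_mul (-2))
  simpa using h

theorem setIntegral_Iic_hermiteFun_add_two (n : ℕ) (x : ℝ) :
    ∫ t in Set.Iic x, hermiteFun (n + 2) t
      = (n + 1) * (∫ t in Set.Iic x, hermiteFun n t) - 2 * hermiteFun (n + 1) x := by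
  have h := integral_Iic_of_hasDerivAt_of_tendsto'
    (fun t (_ : t ∈ Set.Iic x) => hasDerivAt_neg_two_mul_hermiteFun n t)
    (RapidDecay.integrable (by fun_prop)).integrableOn
    ((tendsto_hermiteFun_atBot (n + 1)).const_mul (-2))
  rw [integral_sub (RapidDecay.integrable (by fun_prop)).restrict
    (RapidDecay.integrable (by fun_prop)).restrict, integral_const_mul] at h
  linarith

end HermiteFunctions

section Constants

/-- The integration constant `A_n` in the normalization of `hermiteFun`. -/
noncomputable def hermiteConst (n : ℕ) : ℝ :=
  √(√(2 * Real.pi) * n !) * Aconst n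

theorem Dconst_pos (n : ℕ) : 0 < Dconst n := by
  have h1 := Nat.doubleFactorial_pos (n - 1)
  have h2 := Nat.doubleFactorial_pos n
  unfold Dconst
  positivity

theorem Dconst_add_two (n : ℕ) : Dconst (n + 2) = Dconst n * √((n + 1) / (n + 2)) := by
  have h : Nat.doubleFactorial (n + 2 - 1) = (n + 1) * Nat.doubleFactorial (n - 1) := by
    cases n with
    | zero => rfl
    | succ n => exact Nat.doubleFactorial_add_two n
  unfold Dconst
  rw [h, Nat.doubleFactorial_add_two, mul_assoc _ (√_), ← Real.sqrt_mul (by positivity)]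
  congr 2
  push_cast
  have := Nat.doubleFactorial_pos n
  field_simp

theorem sqrt_sqrt_mul_Dconst_zero : √(√(2 * Real.pi)) * Dconst 0 = 2 * √Real.pi := by
  have hπ := Real.pi_pos
  have h1 : (Real.pi ^ ((1 : ℝ) / 4)) ^ 2 = √Real.pi := by
    rw [Real.sqrt_eq_rpow, ← Real.rpow_natCast, ← Real.rpow_mul hπ.le]
    norm_num
  have h2 : ((2 : ℝ) ^ ((3 : ℝ) / 4)) ^ 2 = 2 * √2 := by
    rw [Real.sqrt_eq_rpow, ← Real.rpow_natCast, ← Real.rpow_mul (by norm_num)]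
    nth_rewrite 2 [← Real.rpow_one 2]
    rw [← Real.rpow_add (by norm_num)]
    norm_num
  refine (pow_left_inj₀ (by have := (Dconst_pos 0).le; positivity) (by positivity)
    two_ne_zero).1 ?_
  have h3 : Dconst 0 = Real.pi ^ ((1 : ℝ) / 4) * (2 : ℝ) ^ ((3 : ℝ) / 4) := by simp [Dconst]
  rw [mul_pow, h3, mul_pow, h1, h2, Real.sq_sqrt (Real.sqrt_nonneg _),
    Real.sqrt_mul (by norm_num), mul_pow, Real.sq_sqrt hπ.le]
  have := Real.mul_self_sqrt (show (0 : ℝ) ≤ 2 by norm_num)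
  have := Real.mul_self_sqrt hπ.le
  grind

theorem hermiteConst_zero : hermiteConst 0 = -√Real.pi / 2 := by
  have := sqrt_sqrt_mul_Dconst_zero
  simp only [hermiteConst, Aconst, Nat.factorial_zero, Nat.cast_one, mul_one, Nat.zero_mod,
    if_true]
  linarith

theorem hermiteConst_one_mul : hermiteConst 1 * (2 * √Real.pi) = √(2 * Real.pi) := by
  have h := (Dconst_pos 0).ne'
  have hs := Real.mul_self_sqrt (Real.sqrt_nonneg (2 * Real.pi))
  rw [← sqrt_sqrt_mul_Dconst_zero]
  simp only [hermiteConst, Aconst, Nat.factorial_one, Nat.cast_one, mul_one, Nat.one_mod,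
    one_ne_zero, if_false, Real.sqrt_one, inv_one, one_mul, Nat.sub_self]
  field_simp
  linarith

theorem sqrt_norm_add_two (n : ℕ) : √(√(2 * Real.pi) * (n + 2)!)
    = √(√(2 * Real.pi) * n !) * (√(n + 1) * √(n + 2)) := by
  rw [← Real.sqrt_mul (by positivity), ← Real.sqrt_mul (by positivity)]
  congr 1
  rw [Nat.factorial_succ, Nat.factorial_succ]
  push_cast
  ring

theorem hermiteConst_add_two (n : ℕ) : hermiteConst (n + 2) = (n + 1) * hermiteConst n := by
  have h1 := Real.mul_self_sqrt (show (0 : ℝ) ≤ (n : ℝ) + 1 by positivity)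
  have p1 : 0 < √((n : ℝ) + 1) := by positivity
  have p2 : 0 < √((n : ℝ) + 2) := by positivity
  unfold hermiteConst Aconst
  rw [sqrt_norm_add_two, Nat.add_mod_right]
  split_ifs with hn
  · rw [Dconst_add_two, Real.sqrt_div (by positivity)]
    field_simp
    rw [Real.sq_sqrt (by positivity)]
  · obtain ⟨m, rfl⟩ : ∃ m, n = m + 1 := ⟨n - 1, by omega⟩
    have hD := (Dconst_pos m).ne'
    have p3 : 0 < √((m : ℝ) + 1) := by positivity
    have h3 := Real.mul_self_sqrt (show (0 : ℝ) ≤ (m : ℝ) + 1 by positivity)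
    rw [show m + 1 + 2 - 1 = m + 2 from rfl, Nat.add_sub_cancel, Dconst_add_two,
      Real.sqrt_div (by positivity)]
    push_cast at *
    rw [show (m : ℝ) + 1 + 2 = m + 3 by ring, show (m : ℝ) + 1 + 1 = m + 2 by ring] at *
    field_simp
    rw [Real.sq_sqrt (by positivity)]

end Constants

section Primitive

/-- The primitive `q_n / 2 + A_n` in the normalization of `hermiteFun`. -/
noncomputable def hermitePrimitive (n : ℕ) (x : ℝ) : ℝ :=
  (∫ t in Set.Iic x, hermiteFun n t) / 2 + hermiteConst n

theorem hasDerivAt_hermitePrimitive (n : ℕ) (x : ℝ) :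
    HasDerivAt (hermitePrimitive n) (hermiteFun n x / 2) x := by
  have hF := rapidDecay_hermiteFun n
  have hQ : ∀ x, ∫ t in Set.Iic x, hermiteFun n t
      = (∫ t in Set.Iic 0, hermiteFun n t) + ∫ t in (0 : ℝ)..x, hermiteFun n t := fun x => by
    rw [← intervalIntegral.integral_Iic_sub_Iic hF.integrable.integrableOn
      hF.integrable.integrableOn]
    ring
  have h : hermitePrimitive n = fun x => ((∫ t in Set.Iic 0, hermiteFun n t)
      + ∫ t in (0 : ℝ)..x, hermiteFun n t) / 2 + hermiteConst n :=
    funext fun x => by rw [hermitePrimitive, hQ x]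
  rw [h]
  exact (((hF.1.integral_hasStrictDerivAt 0 x).hasDerivAt.const_add _).div_const 2).add_const _

@[fun_prop]
theorem polyGrowth_hermitePrimitive (n : ℕ) : PolyGrowth (hermitePrimitive n) := by
  refine .of_bounded
    (continuous_iff_continuousAt.2 fun x => (hasDerivAt_hermitePrimitive n x).continuousAt)
    (C := (∫ t, ‖hermiteFun n t‖) / 2 + ‖hermiteConst n‖) fun x => ?_
  refine (norm_add_le _ _).trans ?_
  rw [norm_div, Real.norm_ofNat]
  gcongr
  exact (norm_integral_le_integral_norm _).trans (setIntegral_le_integral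
    (rapidDecay_hermiteFun n).integrable.norm (.of_forall fun _ => norm_nonneg _))

theorem hermitePrimitive_one (x : ℝ) :
    hermitePrimitive 1 x = -hermiteFun 0 x + hermiteConst 1 := by
  rw [hermitePrimitive, setIntegral_Iic_hermiteFun_one]
  ring

theorem hermitePrimitive_add_two (n : ℕ) (x : ℝ) :
    hermitePrimitive (n + 2) x = (n + 1) * hermitePrimitive n x - hermiteFun (n + 1) x := by
  rw [hermitePrimitive, setIntegral_Iic_hermiteFun_add_two, hermiteConst_add_two,
    hermitePrimitive]
  ring

/-- The integration constants make the limits of `hermitePrimitive n` at `±∞` agree up to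
sign. -/
theorem integral_hermiteFun_mul_hermiteConst (n : ℕ) :
    (∫ x, hermiteFun n x) * ((∫ x, hermiteFun n x) / 4 + hermiteConst n) = 0 := by
  induction n using Nat.twoStepInduction with
  | zero =>
    rw [integral_hermiteFun_zero, hermiteConst_zero]
    ring
  | one => rw [integral_hermiteFun_one, zero_mul]
  | more n h0 _ =>
    rw [integral_hermiteFun_add_two, hermiteConst_add_two]
    linear_combination ((n : ℝ) + 1) ^ 2 * h0

theorem tendsto_hermitePrimitive_atTop (n : ℕ) :
    Tendsto (hermitePrimitive n) atTop (𝓝 ((∫ x, hermiteFun n x) / 2 + hermiteConst n)) :=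
  (((aecover_Iic tendsto_id).integral_tendsto_of_countably_generated
    (rapidDecay_hermiteFun n).integrable).div_const 2).add_const _

theorem tendsto_hermitePrimitive_atBot (n : ℕ) :
    Tendsto (hermitePrimitive n) atBot (𝓝 (hermiteConst n)) := by
  have hF := (rapidDecay_hermiteFun n).integrable
  have h : ∀ x, ∫ t in Set.Iic x, hermiteFun n t
      = (∫ t, hermiteFun n t) - ∫ t in Set.Ioi x, hermiteFun n t := fun x => by
    rw [← intervalIntegral.integral_Iic_add_Ioi hF.integrableOn hF.integrableOn (b := x),
      add_sub_cancel_right]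
  have h' : Tendsto (fun x => ∫ t in Set.Ioi x, hermiteFun n t) atBot
      (𝓝 (∫ t, hermiteFun n t)) :=
    (aecover_Ioi tendsto_id).integral_tendsto_of_countably_generated hF
  have hP : hermitePrimitive n = fun x =>
      ((∫ t, hermiteFun n t) - ∫ t in Set.Ioi x, hermiteFun n t) / 2 + hermiteConst n :=
    funext fun x => by rw [hermitePrimitive, h x]
  rw [hP]
  simpa using
    ((h'.const_sub (∫ t, hermiteFun n t)).div_const 2).add_const (hermiteConst n)

theorem integral_hermiteFun_mul_hermitePrimitive (n : ℕ) :
    ∫ x, hermiteFun n x * hermitePrimitive n x = 0 := by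
  have h := integral_of_hasDerivAt_of_tendsto
    (f := fun x => hermitePrimitive n x ^ 2)
    (f' := fun x => hermiteFun n x * hermitePrimitive n x)
    (fun x => ((hasDerivAt_hermitePrimitive n x).fun_pow 2).congr_deriv (by push_cast; ring))
    (RapidDecay.integrable (by fun_prop))
    ((tendsto_hermitePrimitive_atBot n).pow 2) ((tendsto_hermitePrimitive_atTop n).pow 2)
  rw [h]
  linear_combination integral_hermiteFun_mul_hermiteConst n

theorem integral_hermiteFun_succ_mul_hermitePrimitive (n : ℕ) :
    ∫ x, hermiteFun (n + 1) x * hermitePrimitive (n + 2) x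
      = (n + 1) * (∫ x, hermiteFun (n + 1) x * hermitePrimitive n x)
        - √(2 * Real.pi) * (n + 1)! := by
  have h : ∀ x, hermiteFun (n + 1) x * hermitePrimitive (n + 2) x
      = (n + 1) * (hermiteFun (n + 1) x * hermitePrimitive n x) - hermiteFun (n + 1) x ^ 2 :=
    fun x => by rw [hermitePrimitive_add_two]; ring
  simp_rw [h]
  rw [integral_sub (RapidDecay.integrable (by fun_prop)) (RapidDecay.integrable (by fun_prop)),
    integral_const_mul, integral_hermiteFun_sq]

theorem integral_hermiteFun_mul_hermitePrimitive_succ (n : ℕ) :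
    ∫ x, hermiteFun n x * hermitePrimitive (n + 1) x = 0 := by
  induction n using Nat.twoStepInduction with
  | zero =>
    have h : ∀ x, hermiteFun 0 x * hermitePrimitive (0 + 1) x
        = hermiteConst 1 * hermiteFun 0 x - hermiteFun 0 x ^ 2 :=
      fun x => by rw [zero_add, hermitePrimitive_one]; ring
    simp_rw [h]
    rw [integral_sub (RapidDecay.integrable (by fun_prop)) (RapidDecay.integrable (by fun_prop)),
      integral_const_mul, integral_hermiteFun_sq, integral_hermiteFun_zero, hermiteConst_one_mul]
    simp
  | one =>
    have key : ∫ x, (hermiteFun 1 x * hermitePrimitive 0 x - hermiteFun 0 x ^ 2) = 0 := by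
      refine RapidDecay.integral_deriv_eq_zero
        (f := fun x => -2 * hermiteFun 0 x * hermitePrimitive 0 x) (by fun_prop) (by fun_prop)
        fun x => ?_
      refine ((hasDerivAt_neg_two_mul_hermiteFun_zero x).mul
        (hasDerivAt_hermitePrimitive 0 x)).congr_deriv ?_
      ring
    rw [integral_sub (RapidDecay.integrable (by fun_prop)) (RapidDecay.integrable (by fun_prop)),
      sub_eq_zero, integral_hermiteFun_sq] at key
    have h := integral_hermiteFun_succ_mul_hermitePrimitive 0
    rw [zero_add, key] at h
    simpa using h
  | more n h0 _ =>
    have key : ∫ x, (hermiteFun (n + 2) x * hermitePrimitive (n + 1) x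
        - (n + 1) * (hermiteFun n x * hermitePrimitive (n + 1) x)
        - hermiteFun (n + 1) x ^ 2) = 0 := by
      refine RapidDecay.integral_deriv_eq_zero
        (f := fun x => -2 * hermiteFun (n + 1) x * hermitePrimitive (n + 1) x) (by fun_prop)
        (by fun_prop) fun x => ?_
      refine ((hasDerivAt_neg_two_mul_hermiteFun n x).mul
        (hasDerivAt_hermitePrimitive (n + 1) x)).congr_deriv ?_
      ring
    rw [integral_sub (RapidDecay.integrable (by fun_prop)) (RapidDecay.integrable (by fun_prop)),
      integral_sub (RapidDecay.integrable (by fun_prop)) (RapidDecay.integrable (by fun_prop)),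
      integral_const_mul, h0, mul_zero, sub_zero, sub_eq_zero, integral_hermiteFun_sq] at key
    rw [integral_hermiteFun_succ_mul_hermitePrimitive (n + 1), key, Nat.factorial_succ (n + 1)]
    push_cast
    ring

end Primitive

section Resolvent

theorem qFun_eq (n : ℕ) (x : ℝ) :
    qFun n x = (∫ t in Set.Iic x, hermiteFun n t) / √(√(2 * Real.pi) * n !) := by
  rw [qFun, ← integral_div]
  congr 1 with t
  rw [pOrtho, hermiteFun]
  ring

theorem deriv_pOrtho (n : ℕ) (x : ℝ) :
    deriv (pOrtho n) x = (x * Polynomial.aeval x (Polynomial.hermite n)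
      - Polynomial.aeval x (Polynomial.hermite (n + 1))) / √(√(2 * Real.pi) * n !) :=
  ((hasDerivAt_aeval_hermite n x).div_const _).deriv

theorem goeDensity_succ (n : ℕ) (x : ℝ) :
    goeDensity (n + 1) x = (√(2 * Real.pi) * n !)⁻¹ *
      ladderDensity (hermiteFun n) (hermiteFun (n + 1)) (hermitePrimitive (n + 1))
        ((n + 1 : ℕ) : ℝ) x := by
  have hβ : √(√(2 * Real.pi) * (n + 1)!) = √((n + 1 : ℕ) : ℝ) * √(√(2 * Real.pi) * n !) := by
    rw [← Real.sqrt_mul (by positivity), Nat.factorial_succ]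
    congr 1
    push_cast
    ring
  have hα : 0 < √(√(2 * Real.pi) * n !) := by positivity
  have hν : 0 < √((n + 1 : ℕ) : ℝ) := by positivity
  have hrec : (Polynomial.aeval x (Polynomial.hermite (n + 1 + 1)) : ℝ)
      = x * Polynomial.aeval x (Polynomial.hermite (n + 1))
        - (n + 1) * Polynomial.aeval x (Polynomial.hermite n) := by
    rw [Polynomial.hermite_succ (n + 1), derivative_hermite_succ]
    simp
  have hE : Real.exp (-x ^ 2 / 2) = Real.exp (-x ^ 2 / 4) ^ 2 := by
    rw [← Real.exp_nat_mul]
    congr 1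
    push_cast
    ring
  have hα2 : (√(2 * Real.pi) * (n ! : ℝ))⁻¹ = (√(√(2 * Real.pi) * n !))⁻¹ ^ 2 := by
    rw [inv_pow, Real.sq_sqrt (by positivity)]
  have hν2 : ((n + 1 : ℕ) : ℝ) = √((n + 1 : ℕ) : ℝ) ^ 2 := (Real.sq_sqrt (by positivity)).symm
  rw [goeDensity, qFun_eq, deriv_pOrtho, Nat.add_sub_cancel, deriv_pOrtho, hrec, hE,
    ladderDensity, hermitePrimitive, hermiteConst, pOrtho, pOrtho, hβ, hα2,
    ← Nat.cast_add_one (R := ℝ) n]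
  generalize (∫ t in Set.Iic x, hermiteFun (n + 1) t) = I
  unfold hermiteFun
  generalize √(√(2 * Real.pi) * n !) = α at hα ⊢
  generalize √((n + 1 : ℕ) : ℝ) = ν at hν hν2 ⊢
  rw [hν2]
  field_simp
  ring

theorem rapidDecay_goeDensity_succ (n : ℕ) : RapidDecay (goeDensity (n + 1)) := by
  rw [funext (goeDensity_succ n)]
  unfold ladderDensity
  fun_prop

/-- The resolvent equation for the unscaled density. -/
theorem integral_cauchyKernel_goeDensity (n : ℕ) {w : ℂ} (hw : w.im ≠ 0) :
    480 * (∫ s : ℝ, (goeDensity (n + 1) s : ℂ) * (w - (s : ℂ))⁻¹ ^ 6)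
      - 30 * (w ^ 2 - (4 * (n + 1 : ℕ) - 2))
        * (∫ s : ℝ, (goeDensity (n + 1) s : ℂ) * (w - (s : ℂ))⁻¹ ^ 4)
      - 12 * w * (∫ s : ℝ, (goeDensity (n + 1) s : ℂ) * (w - (s : ℂ))⁻¹ ^ 3)
      - (-w ^ 4 + 2 * (4 * (n + 1 : ℕ) - 2) * w ^ 2
          + (-16 * (n + 1 : ℕ) ^ 2 + 16 * (n + 1 : ℕ) + 2))
        * (∫ s : ℝ, (goeDensity (n + 1) s : ℂ) * (w - (s : ℂ))⁻¹ ^ 2)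
      + w * (w ^ 2 - (4 * (n + 1 : ℕ) - 2))
        * (∫ s : ℝ, (goeDensity (n + 1) s : ℂ) * (w - (s : ℂ))⁻¹)
      = 2 * (n + 1 : ℕ) * w ^ 2 - 8 * (n + 1 : ℕ) ^ 2 + 10 * (n + 1 : ℕ) := by
  have hρ := rapidDecay_goeDensity_succ n
  have hK := polyGrowth_inv_sub hw
  have hκ : √(2 * Real.pi) * (n ! : ℝ) ≠ 0 := by positivity
  have key := integral_cauchyKernel_ladderDensity (rapidDecay_hermiteFun n)
    (rapidDecay_hermiteFun (n + 1)) (polyGrowth_hermitePrimitive (n + 1))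
    (hasDerivAt_hermiteFun n) (by exact_mod_cast hasDerivAt_hermiteFun_succ n)
    (hasDerivAt_hermitePrimitive (n + 1)) (integral_hermiteFun_sq n)
    (integral_hermiteFun_mul_hermitePrimitive_succ n)
    (integral_hermiteFun_mul_hermitePrimitive (n + 1)) hw
  have hL : ∀ s, ladderDensity (hermiteFun n) (hermiteFun (n + 1)) (hermitePrimitive (n + 1))
      ((n + 1 : ℕ) : ℝ) s = (√(2 * Real.pi) * n !) * goeDensity (n + 1) s := fun s => by
    rw [goeDensity_succ, mul_inv_cancel_left₀ hκ]
  have hκ' : ((√(2 * Real.pi) * (n ! : ℝ) : ℝ) : ℂ) ≠ 0 := by exact_mod_cast hκ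
  simp only [hL] at key
  rw [← mul_left_inj' hκ']
  refine Eq.trans ?_ (key.trans (by push_cast; ring))
  simp only [← integral_const_mul]
  rw [← integral_sub (RapidDecay.integrable (by fun_prop)) (RapidDecay.integrable (by fun_prop)),
    ← integral_sub (RapidDecay.integrable (by fun_prop)) (RapidDecay.integrable (by fun_prop)),
    ← integral_sub (RapidDecay.integrable (by fun_prop)) (RapidDecay.integrable (by fun_prop)),
    ← integral_add (RapidDecay.integrable (by fun_prop)) (RapidDecay.integrable (by fun_prop)),
    ← integral_mul_const]
  congr 1 with s
  push_cast
  ring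

theorem iteratedDeriv_goeResolvent (n : ℕ) {g : ℝ} (hg : 0 < g) (k : ℕ) {z : ℂ}
    (hz : z.im ≠ 0) :
    iteratedDeriv k (goeResolvent (n + 1) g) z = (-1) ^ k * k !
      * (√((n + 1 : ℕ) / g) : ℂ) ^ (k + 1) * ∫ s : ℝ, (goeDensity (n + 1) s : ℂ)
        * ((√((n + 1 : ℕ) / g) : ℂ) * z - (s : ℂ))⁻¹ ^ (k + 1) := by
  have hc : 0 < √((n + 1 : ℕ) / g) := by positivity
  have hR : goeResolvent (n + 1) g =
      fun z => ∫ t : ℝ, (goeDensityScaled (n + 1) g t : ℂ) * (z - (t : ℂ))⁻¹ := by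
    funext z
    simp only [goeResolvent, div_eq_mul_inv]
  have hI : Integrable fun t : ℝ => (goeDensityScaled (n + 1) g t : ℂ) :=
    (((rapidDecay_goeDensity_succ n).integrable.comp_mul_left' hc.ne').const_mul _).ofReal
  rw [hR, iteratedDeriv_integral_inv_sub hI k hz]
  unfold goeDensityScaled
  generalize √((n + 1 : ℕ) / g) = c at hc ⊢
  have hc' : (c : ℂ) ≠ 0 := by exact_mod_cast hc.ne'
  have hcv := Measure.integral_comp_mul_left
    (fun s : ℝ => (goeDensity (n + 1) s : ℂ) * ((c : ℂ) * z - (s : ℂ))⁻¹ ^ (k + 1)) c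
  rw [abs_of_pos (inv_pos.2 hc), Complex.real_smul, Complex.ofReal_inv,
    eq_inv_mul_iff_mul_eq₀ hc'] at hcv
  rw [← hcv, mul_assoc (_ * _) (_ ^ _)]
  congr 1
  rw [← integral_const_mul, ← integral_const_mul]
  congr 1 with t
  rw [Complex.ofReal_mul c t, ← mul_sub, mul_inv, mul_pow, inv_pow, inv_pow]
  push_cast
  field_simp

end Resolvent

/-- The GOE resolvent satisfies the fifth order inhomogeneous ODE
`−4(g⁴/N⁴)W⁽⁵⁾ + 5(z²−(4N−2)(g/N))(g²/N²)W''' − 6(g²/N²)zW''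
  + (−z⁴+(8N−4)(g/N)z²+(−16N²+16N+2)(g²/N²))W' + z(z²−(4N−2)(g/N))W
  = 2N(z²−4g)+10g` off the real axis. -/
theorem goeResolvent_ode (N : ℕ) (hN : 2 ≤ N) (g : ℝ) (hg : 0 < g)
    (z : ℂ) (hz : z.im ≠ 0) :
    -4 * ((g : ℂ) ^ 4 / (N : ℂ) ^ 4) * iteratedDeriv 5 (goeResolvent N g) z +
        5 * (z ^ 2 - (4 * (N : ℂ) - 2) * ((g : ℂ) / (N : ℂ))) * ((g : ℂ) ^ 2 / (N : ℂ) ^ 2) *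
          iteratedDeriv 3 (goeResolvent N g) z -
        6 * ((g : ℂ) ^ 2 / (N : ℂ) ^ 2) * z * iteratedDeriv 2 (goeResolvent N g) z +
        (-z ^ 4 + (8 * (N : ℂ) - 4) * ((g : ℂ) / (N : ℂ)) * z ^ 2 +
            (-16 * (N : ℂ) ^ 2 + 16 * (N : ℂ) + 2) * ((g : ℂ) ^ 2 / (N : ℂ) ^ 2)) *
          deriv (goeResolvent N g) z +
        z * (z ^ 2 - (4 * (N : ℂ) - 2) * ((g : ℂ) / (N : ℂ))) * goeResolvent N g z =
      2 * (N : ℂ) * (z ^ 2 - 4 * (g : ℂ)) + 10 * (g : ℂ) := by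
  obtain ⟨n, rfl⟩ : ∃ n, N = n + 1 := ⟨N - 1, by omega⟩
  have hc : 0 < √((n + 1 : ℕ) / g) := by positivity
  have hcg : (√((n + 1 : ℕ) / g) : ℂ) ^ 2 * g = (n + 1 : ℕ) := by
    rw [← Complex.ofReal_pow, Real.sq_sqrt (by positivity), ← Complex.ofReal_mul,
      div_mul_cancel₀ _ hg.ne', Complex.ofReal_natCast]
  have hD := fun k => iteratedDeriv_goeResolvent n hg k hz
  have h0 := hD 0
  have h1 := hD 1
  rw [iteratedDeriv_zero] at h0
  rw [iteratedDeriv_one] at h1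
  rw [hD 5, hD 3, hD 2, h1, h0]
  generalize √((n + 1 : ℕ) / g) = c at hc hcg ⊢
  have hc0 : (c : ℂ) ≠ 0 := by exact_mod_cast hc.ne'
  have hw : ((c : ℂ) * z).im ≠ 0 := by simpa using ⟨hc.ne', hz⟩
  have key := integral_cauchyKernel_goeDensity n hw
  have hN0 : ((n + 1 : ℕ) : ℂ) ≠ 0 := by exact_mod_cast n.succ_ne_zero
  generalize ((n + 1 : ℕ) : ℂ) = ν at hcg hN0 key ⊢
  generalize (g : ℂ) = γ at hcg ⊢
  obtain rfl : γ = ν / (c : ℂ) ^ 2 := by rw [← hcg]; field_simp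
  simp only [Nat.reduceAdd, zero_add, pow_one] at *
  generalize (c : ℂ) = b at *
  generalize (∫ s : ℝ, (goeDensity (n + 1) s : ℂ) * (b * z - (s : ℂ))⁻¹ ^ 6) = M₆ at *
  generalize (∫ s : ℝ, (goeDensity (n + 1) s : ℂ) * (b * z - (s : ℂ))⁻¹ ^ 4) = M₄ at *
  generalize (∫ s : ℝ, (goeDensity (n + 1) s : ℂ) * (b * z - (s : ℂ))⁻¹ ^ 3) = M₃ at *
  generalize (∫ s : ℝ, (goeDensity (n + 1) s : ℂ) * (b * z - (s : ℂ))⁻¹ ^ 2) = M₂ at *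
  generalize (∫ s : ℝ, (goeDensity (n + 1) s : ℂ) * (b * z - (s : ℂ))⁻¹) = M₁ at *
  simp only [Nat.factorial]
  push_cast
  field_simp
  linear_combination key
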